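/- arXiv:1911.08233 — 9 statements merged into one kernel-verified Lean document; each statement's English description precedes it below -/
import Mathlib

section
/- Let Ω ⊂ ℝ^M be a bounded measurable set, f : ℝ^M → ℝ^N a bounded measurable function, and let the dual-affine kernel of degree L be K_f(x₁,…,x_L) = ∏_{i=1}^{p} det(x_{σ_i(1)},…,x_{σ_i(M)})^{t_i} · ∏_{j=1}^{q} det(f(x_{τ_j(1)}),…,f(x_{τ_j(N)}))^{s_j}, with O_S = Σ t_i and O_C = Σ s_j. Define Covariant(Ω,f) = ∫_{Ω^L} K_f(x₁,…,x_L) dx₁⋯dx_L. Let A_M be an invertible M×M real matrix and A_N an invertible N×N real matrix; set Ω* = {A_M x : x ∈ Ω} and f*(x) = A_N·f(A_M⁻¹·x). Then Covariant(Ω*, f*) = det(A_M)^{O_S} · |det(A_M)|^{L} · det(A_N)^{O_C} · Covariant(Ω, f). -/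
open MeasureTheory

/-- Applying a matrix to each column of a square array multiplies the determinant by its own. -/
theorem det_of_mulVec_columns {n : ℕ} (A : Matrix (Fin n) (Fin n) ℝ) (v : Fin n → Fin n → ℝ) :
    (Matrix.of fun r c => A.mulVec (v c) r).det
      = A.det * (Matrix.of fun r c => v c r).det := by
  rw [← Matrix.det_mul]
  rfl

/-- Change of variables in a product `Ω^L` under an invertible matrix acting on every factor. -/
theorem setIntegral_pi_image_mulVec {M L : ℕ} {Ω : Set (Fin M → ℝ)} (hΩ : MeasurableSet Ω)
    {A : Matrix (Fin M) (Fin M) ℝ} (hA : IsUnit A.det) (g : (Fin L → Fin M → ℝ) → ℝ) :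
    ∫ x in Set.univ.pi (fun _ => A.mulVec '' Ω), g x
      = |A.det| ^ L * ∫ x in Set.univ.pi (fun _ => Ω), g (fun i => A.mulVec (x i)) := by
  let T : (Fin M → ℝ) →L[ℝ] (Fin M → ℝ) := LinearMap.toContinuousLinearMap (Matrix.toLin' A)
  let F : (Fin L → Fin M → ℝ) →L[ℝ] (Fin L → Fin M → ℝ) :=
    ContinuousLinearMap.pi fun i => T.comp (ContinuousLinearMap.proj i)
  have hF : ⇑F = Pi.map fun _ => A.mulVec := rfl
  have hdet : |F.det| = |A.det| ^ L := by
    have hT : T.det = A.det := LinearMap.det_toLin' A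
    rw [ContinuousLinearMap.det_pi, Finset.prod_const, Finset.card_univ, Fintype.card_fin,
      abs_pow, hT]
  have hinj : Function.Injective F := by
    rw [hF]
    exact Function.Injective.piMap fun _ =>
      Matrix.mulVec_injective_of_isUnit ((Matrix.isUnit_iff_isUnit_det A).2 hA)
  rw [← Set.piMap_image_univ_pi, ← hF,
    integral_image_eq_integral_abs_det_fderiv_smul volume
      (MeasurableSet.univ_pi fun _ => hΩ) (fun x _ => F.hasFDerivAt.hasFDerivWithinAt)
      hinj.injOn, integral_smul, hdet, smul_eq_mul]
  rfl

/-- The dual-affine covariant, the integral over `Ω^L` of the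
dual-affine kernel
`K_f(x₁,…,x_L) = ∏ᵢ det(x_{σᵢ(1)},…,x_{σᵢ(M)})^{tᵢ} · ∏ⱼ det(f(x_{τⱼ(1)}),…,f(x_{τⱼ(N)}))^{sⱼ}`,
transforms under the dual-affine transformation `(A_M, A_N)` (with
`Ω* = A_M '' Ω` and `f* = A_N · f ∘ A_M⁻¹`) by the factor
`det(A_M)^{O_S} · |det(A_M)|^L · det(A_N)^{O_C}`. -/
theorem covariant_dual_affine (M N L p q : ℕ)
    (Ω : Set (Fin M → ℝ)) (hΩm : MeasurableSet Ω) (hΩb : Bornology.IsBounded Ω)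
    (f : (Fin M → ℝ) → (Fin N → ℝ)) (hfm : Measurable f)
    (hfb : ∃ C : ℝ, ∀ x, ‖f x‖ ≤ C)
    (σ : Fin p → Fin M → Fin L) (t : Fin p → ℕ)
    (τ : Fin q → Fin N → Fin L) (s : Fin q → ℕ)
    (O_S O_C : ℕ) (hOS : O_S = ∑ i, t i) (hOC : O_C = ∑ j, s j)
    (A_M : Matrix (Fin M) (Fin M) ℝ) (hAM : IsUnit A_M.det)
    (A_N : Matrix (Fin N) (Fin N) ℝ) (hAN : IsUnit A_N.det) :
    (∫ x : Fin L → (Fin M → ℝ) in Set.univ.pi (fun _ => A_M.mulVec '' Ω),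
        (∏ i, (Matrix.of fun r c => x (σ i c) r).det ^ t i) *
        (∏ j, (Matrix.of fun r c =>
            A_N.mulVec (f (A_M⁻¹.mulVec (x (τ j c)))) r).det ^ s j))
      = A_M.det ^ O_S * |A_M.det| ^ L * A_N.det ^ O_C *
        ∫ x : Fin L → (Fin M → ℝ) in Set.univ.pi (fun _ => Ω),
          (∏ i, (Matrix.of fun r c => x (σ i c) r).det ^ t i) *
          (∏ j, (Matrix.of fun r c => f (x (τ j c)) r).det ^ s j) := by
  rw [setIntegral_pi_image_mulVec hΩm hAM, ← integral_const_mul, ← integral_const_mul]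
  congr 1 with x
  simp only [Matrix.mulVec_mulVec, Matrix.nonsing_inv_mul _ hAM, Matrix.one_mulVec,
    det_of_mulVec_columns, mul_pow, Finset.prod_mul_distrib, Finset.prod_pow_eq_pow_sum,
    ← hOS, ← hOC]
  ring
end

section
/- Let Ω ⊂ ℝ^M be a bounded measurable set of positive Lebesgue measure V = vol(Ω), f : ℝ^M → ℝ^N a bounded measurable function, and let Covariant(Ω,f) = ∫_{Ω^L} K_f(x₁,…,x_L) dx₁⋯dx_L be the integral of a dual-affine kernel of degree L with shape order O_S and channel order O_C. Let D(Ω,f) = ∫_{Ω^N} det(f(y₁),…,f(y_N))² dy₁⋯dy_N and assume D(Ω,f) > 0. Define the normalized quantity Invariant(Ω,f) = Covariant(Ω,f) / ( V^{O_S + L − N·O_C/2} · D(Ω,f)^{O_C/2} ), the powers being real powers of the positive numbers V and D. Then for any M×M real matrix A_M with det(A_M) > 0 and any N×N real matrix A_N with det(A_N) > 0, setting Ω* = {A_M x : x ∈ Ω} and f*(x) = A_N·f(A_M⁻¹·x), one has Invariant(Ω*, f*) = Invariant(Ω, f). -/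
open MeasureTheory

/-- The dual-affine covariant of degree `L`: the integral over `Ω^L` of the kernel
`∏ᵢ det(x_{σᵢ(1)},…,x_{σᵢ(M)})^{tᵢ} · ∏ⱼ det(f(x_{τⱼ(1)}),…,f(x_{τⱼ(N)}))^{sⱼ}`. -/
noncomputable def damiCovariant (M N L p q : ℕ)
    (σ : Fin p → Fin M → Fin L) (t : Fin p → ℕ)
    (τ : Fin q → Fin N → Fin L) (s : Fin q → ℕ)
    (Ω : Set (Fin M → ℝ)) (f : (Fin M → ℝ) → (Fin N → ℝ)) : ℝ :=
  ∫ x : Fin L → (Fin M → ℝ) in Set.univ.pi (fun _ => Ω),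
    (∏ i, (Matrix.of fun r c => x (σ i c) r).det ^ t i) *
    (∏ j, (Matrix.of fun r c => f (x (τ j c)) r).det ^ s j)

/-- `D(Ω,f) = ∫_{Ω^N} det(f(y₁),…,f(y_N))² dy₁⋯dy_N`. -/
noncomputable def damiD (M N : ℕ)
    (Ω : Set (Fin M → ℝ)) (f : (Fin M → ℝ) → (Fin N → ℝ)) : ℝ :=
  ∫ y : Fin N → (Fin M → ℝ) in Set.univ.pi (fun _ => Ω),
    (Matrix.of fun r c => f (y c) r).det ^ 2

/-- The normalized quantity
`Invariant(Ω,f) = Covariant(Ω,f) / ( V^{O_S+L−N·O_C/2} · D(Ω,f)^{O_C/2} )`,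
the powers being real powers of the positive numbers `V = vol(Ω)` and `D`. -/
noncomputable def damiInvariant (M N L p q : ℕ)
    (σ : Fin p → Fin M → Fin L) (t : Fin p → ℕ)
    (τ : Fin q → Fin N → Fin L) (s : Fin q → ℕ)
    (O_S O_C : ℕ)
    (Ω : Set (Fin M → ℝ)) (f : (Fin M → ℝ) → (Fin N → ℝ)) : ℝ :=
  damiCovariant M N L p q σ t τ s Ω f /
    ((volume Ω).toReal ^ ((O_S : ℝ) + L - N * O_C / 2) *
      damiD M N Ω f ^ ((O_C : ℝ) / 2))

/-- Change of variables for integrals over a power of the image of `Ω` under an invertible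
matrix. -/
theorem setIntegral_univ_pi_mulVec_image {M k : ℕ} (A : Matrix (Fin M) (Fin M) ℝ)
    (hA : A.det ≠ 0) {Ω : Set (Fin M → ℝ)} (hΩ : MeasurableSet Ω)
    (g : (Fin k → (Fin M → ℝ)) → ℝ) :
    ∫ x in Set.univ.pi (fun _ => A.mulVec '' Ω), g x
      = |A.det| ^ k * ∫ x in Set.univ.pi (fun _ => Ω), g (fun i => A.mulVec (x i)) := by
  let T : (Fin k → (Fin M → ℝ)) →L[ℝ] (Fin k → (Fin M → ℝ)) :=
    ContinuousLinearMap.pi fun i =>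
      (LinearMap.toContinuousLinearMap (Matrix.toLin' A)).comp (ContinuousLinearMap.proj i)
  have hT (x : Fin k → (Fin M → ℝ)) : T x = fun i => A.mulVec (x i) := rfl
  have hdet : T.det = A.det ^ k := by
    rw [ContinuousLinearMap.det_pi]
    simp [ContinuousLinearMap.det]
  have hinj : Function.Injective A.mulVec :=
    Matrix.mulVec_injective_of_isUnit ((Matrix.isUnit_iff_isUnit_det A).2 hA.isUnit)
  have himage : Set.univ.pi (fun _ : Fin k => A.mulVec '' Ω)
      = T '' Set.univ.pi (fun _ => Ω) := by
    change _ = Pi.map (fun _ => A.mulVec) '' _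
    rw [Set.piMap_image_univ_pi]
  have hTinj : Function.Injective T := fun x y hxy =>
    funext fun i => hinj (congrFun hxy i)
  rw [himage, integral_image_eq_integral_abs_det_fderiv_smul volume
    (MeasurableSet.univ_pi fun _ => hΩ) (fun x _ => T.hasFDerivAt.hasFDerivWithinAt)
    hTinj.injOn g]
  simp only [hdet, hT, abs_pow, smul_eq_mul]
  rw [integral_const_mul]

theorem volume_mulVec_image_toReal {M : ℕ} (A : Matrix (Fin M) (Fin M) ℝ)
    (Ω : Set (Fin M → ℝ)) :
    (volume (A.mulVec '' Ω)).toReal = |A.det| * (volume Ω).toReal := by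
  have h := Measure.addHaar_image_linearMap volume (Matrix.toLin' A) Ω
  rw [LinearMap.det_toLin'] at h
  change volume (A.mulVec '' Ω) = _ at h
  rw [h, ENNReal.toReal_mul, ENNReal.toReal_ofReal (abs_nonneg _)]

theorem damiCovariant_dual_affine (M N L p q : ℕ)
    {Ω : Set (Fin M → ℝ)} (hΩ : MeasurableSet Ω) (f : (Fin M → ℝ) → (Fin N → ℝ))
    (σ : Fin p → Fin M → Fin L) (t : Fin p → ℕ)
    (τ : Fin q → Fin N → Fin L) (s : Fin q → ℕ)
    (A : Matrix (Fin M) (Fin M) ℝ) (hA : A.det ≠ 0) (B : Matrix (Fin N) (Fin N) ℝ) :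
    damiCovariant M N L p q σ t τ s (A.mulVec '' Ω)
        (fun x => B.mulVec (f (A⁻¹.mulVec x)))
      = |A.det| ^ L * (A.det ^ (∑ i, t i) * B.det ^ (∑ j, s j)) *
        damiCovariant M N L p q σ t τ s Ω f := by
  have hinv : A⁻¹ * A = 1 := Matrix.nonsing_inv_mul A hA.isUnit
  unfold damiCovariant
  rw [setIntegral_univ_pi_mulVec_image A hA hΩ, mul_assoc]
  congr 1
  rw [← integral_const_mul]
  congr 1
  ext x
  simp only [Matrix.mulVec_mulVec, hinv, Matrix.one_mulVec, det_of_mulVec_columns, mul_pow,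
    Finset.prod_mul_distrib, Finset.prod_pow_eq_pow_sum]
  ring

theorem damiD_dual_affine (M N : ℕ)
    {Ω : Set (Fin M → ℝ)} (hΩ : MeasurableSet Ω) (f : (Fin M → ℝ) → (Fin N → ℝ))
    (A : Matrix (Fin M) (Fin M) ℝ) (hA : A.det ≠ 0) (B : Matrix (Fin N) (Fin N) ℝ) :
    damiD M N (A.mulVec '' Ω) (fun x => B.mulVec (f (A⁻¹.mulVec x)))
      = |A.det| ^ N * B.det ^ 2 * damiD M N Ω f := by
  have hinv : A⁻¹ * A = 1 := Matrix.nonsing_inv_mul A hA.isUnit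
  unfold damiD
  rw [setIntegral_univ_pi_mulVec_image A hA hΩ, mul_assoc]
  simp only [Matrix.mulVec_mulVec, hinv, Matrix.one_mulVec, det_of_mulVec_columns, mul_pow,
    integral_const_mul]

/-- Scaling behaviour of the normalization factor. -/
theorem dami_normalization_scaling {a b V D : ℝ} (ha : 0 < a) (hb : 0 < b) (hV : 0 < V)
    (hD : 0 < D) (N L m n : ℕ) :
    (a * V) ^ ((m : ℝ) + L - N * n / 2) * (a ^ N * b ^ 2 * D) ^ ((n : ℝ) / 2)
      = a ^ L * (a ^ m * b ^ n) *
        (V ^ ((m : ℝ) + L - N * n / 2) * D ^ ((n : ℝ) / 2)) := by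
  have ha' : a ^ ((m : ℝ) + L - N * n / 2) * (a ^ N) ^ ((n : ℝ) / 2) = a ^ L * a ^ m := by
    rw [← Real.rpow_natCast_mul ha.le, ← Real.rpow_add ha, ← pow_add, ← Real.rpow_natCast]
    congr 1
    push_cast
    ring
  have hb' : (b ^ 2) ^ ((n : ℝ) / 2) = b ^ n := by
    rw [← Real.rpow_natCast_mul hb.le, ← Real.rpow_natCast]
    congr 1
    push_cast
    ring
  rw [Real.mul_rpow ha.le hV.le, Real.mul_rpow (by positivity) hD.le,
    Real.mul_rpow (by positivity) (by positivity), hb']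
  linear_combination (V ^ ((m : ℝ) + L - N * n / 2) * D ^ ((n : ℝ) / 2) * b ^ n) * ha'

/-- The normalized dual-affine moment quantity is invariant under every
dual-affine transformation with positive determinants. -/
theorem damiInvariant_dual_affine_invariant (M N L p q : ℕ)
    (Ω : Set (Fin M → ℝ)) (hΩm : MeasurableSet Ω) (hΩb : Bornology.IsBounded Ω)
    (hV : 0 < (volume Ω).toReal)
    (f : (Fin M → ℝ) → (Fin N → ℝ)) (hfm : Measurable f)
    (hfb : ∃ C : ℝ, ∀ x, ‖f x‖ ≤ C)
    (σ : Fin p → Fin M → Fin L) (t : Fin p → ℕ)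
    (τ : Fin q → Fin N → Fin L) (s : Fin q → ℕ)
    (O_S O_C : ℕ) (hOS : O_S = ∑ i, t i) (hOC : O_C = ∑ j, s j)
    (hD : 0 < damiD M N Ω f)
    (A_M : Matrix (Fin M) (Fin M) ℝ) (hAM : 0 < A_M.det)
    (A_N : Matrix (Fin N) (Fin N) ℝ) (hAN : 0 < A_N.det) :
    damiInvariant M N L p q σ t τ s O_S O_C
        (A_M.mulVec '' Ω)
        (fun x => A_N.mulVec (f (A_M⁻¹.mulVec x)))
      = damiInvariant M N L p q σ t τ s O_S O_C Ω f := by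
  unfold damiInvariant
  rw [damiCovariant_dual_affine M N L p q hΩm f σ t τ s A_M hAM.ne' A_N,
    damiD_dual_affine M N hΩm f A_M hAM.ne' A_N, volume_mulVec_image_toReal,
    abs_of_pos hAM, dami_normalization_scaling hAM hAN hV hD, ← hOS, ← hOC]
  exact mul_div_mul_left _ _ (by positivity)
end

section
/- Let Ω ⊂ ℝ³ be a bounded measurable set with V = vol(Ω) > 0 and let f : ℝ³ → ℝ³ be a bounded measurable function. Let x̄ = V⁻¹∫_Ω x dx and f̄ = V⁻¹∫_Ω f(x) dx. Define the 3×3 cross-covariance matrix C = ∫_Ω (x − x̄)(f(x) − f̄)ᵀ dx and the 3×3 channel covariance matrix Σ = ∫_Ω (f(x) − f̄)(f(x) − f̄)ᵀ dx, and assume det(Σ) > 0. Then the quantity DAMI₁(Ω,f) = det(C) / ( √(det Σ) · V^{5/2} ) is invariant under every dual-affine transformation with positive determinants: for any 3×3 real matrices A_M, A_N with det(A_M) > 0 and det(A_N) > 0 and any b, c ∈ ℝ³, setting Ω* = {A_M x + b : x ∈ Ω} and f*(x) = A_N·f(A_M⁻¹(x − b)) + c, one has DAMI₁(Ω*, f*)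 = DAMI₁(Ω, f). -/
open MeasureTheory

/-- Volume of a 3D object. -/
noncomputable def vol3 (Ω : Set (Fin 3 → ℝ)) : ℝ := (volume Ω).toReal

/-- Centroid `x̄ = V⁻¹ ∫_Ω x dx`. -/
noncomputable def centroid3 (Ω : Set (Fin 3 → ℝ)) : Fin 3 → ℝ :=
  (vol3 Ω)⁻¹ • ∫ x in Ω, x

/-- Mean channel value `f̄ = V⁻¹ ∫_Ω f(x) dx`. -/
noncomputable def meanChan3 (Ω : Set (Fin 3 → ℝ))
    (f : (Fin 3 → ℝ) → (Fin 3 → ℝ)) : Fin 3 → ℝ :=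
  (vol3 Ω)⁻¹ • ∫ x in Ω, f x

/-- Cross-covariance matrix `C = ∫_Ω (x − x̄)(f(x) − f̄)ᵀ dx`. -/
noncomputable def crossCov3 (Ω : Set (Fin 3 → ℝ))
    (f : (Fin 3 → ℝ) → (Fin 3 → ℝ)) : Matrix (Fin 3) (Fin 3) ℝ :=
  Matrix.of fun i j =>
    ∫ x in Ω, (x i - centroid3 Ω i) * (f x j - meanChan3 Ω f j)

/-- Channel covariance matrix `Σ = ∫_Ω (f(x) − f̄)(f(x) − f̄)ᵀ dx`. -/
noncomputable def chanCov3 (Ω : Set (Fin 3 → ℝ))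
    (f : (Fin 3 → ℝ) → (Fin 3 → ℝ)) : Matrix (Fin 3) (Fin 3) ℝ :=
  Matrix.of fun i j =>
    ∫ x in Ω, (f x i - meanChan3 Ω f i) * (f x j - meanChan3 Ω f j)

/-- `DAMI₁(Ω,f) = det(C) / ( √(det Σ) · V^{5/2} )`. -/
noncomputable def dami1 (Ω : Set (Fin 3 → ℝ))
    (f : (Fin 3 → ℝ) → (Fin 3 → ℝ)) : ℝ :=
  (crossCov3 Ω f).det / (Real.sqrt (chanCov3 Ω f).det * vol3 Ω ^ ((5 : ℝ) / 2))

section AffineChangeOfVariables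

variable {n : Type*} [Fintype n] [DecidableEq n]

lemma setIntegral_affine_image {F : Type*} [NormedAddCommGroup F] [NormedSpace ℝ F]
    {Ω : Set (n → ℝ)} (hΩ : MeasurableSet Ω) {A : Matrix n n ℝ} (hA : 0 < A.det)
    (b : n → ℝ) (g : (n → ℝ) → F) :
    ∫ x in (fun x => A.mulVec x + b) '' Ω, g x
      = A.det • ∫ x in Ω, g (A.mulVec x + b) := by
  have hderiv : ∀ x ∈ Ω, HasFDerivWithinAt (fun x => A.mulVec x + b)
      (LinearMap.toContinuousLinearMap A.mulVecLin) Ω x := fun x _ =>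
    ((LinearMap.toContinuousLinearMap A.mulVecLin).hasFDerivAt.add_const b).hasFDerivWithinAt
  have hinj : Set.InjOn (fun x => A.mulVec x + b) Ω := fun x _ y _ hxy =>
    Matrix.mulVec_injective_of_isUnit
      ((Matrix.isUnit_iff_isUnit_det A).2 hA.ne'.isUnit) (add_right_cancel hxy)
  have hdet : (LinearMap.toContinuousLinearMap A.mulVecLin).det = A.det := by
    change LinearMap.det A.mulVecLin = A.det
    exact LinearMap.det_toLin' A
  rw [integral_image_eq_integral_abs_det_fderiv_smul volume hΩ hderiv hinj, hdet,
    abs_of_pos hA, integral_smul]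

lemma measureReal_affine_image {Ω : Set (n → ℝ)} (hΩ : MeasurableSet Ω)
    {A : Matrix n n ℝ} (hA : 0 < A.det) (b : n → ℝ) :
    (volume ((fun x => A.mulVec x + b) '' Ω)).toReal = A.det * (volume Ω).toReal := by
  simpa [Measure.real] using setIntegral_affine_image hΩ hA b (fun _ => (1 : ℝ))

end AffineChangeOfVariables

lemma integral_mulVec_add_const {α m n : Type*} [Fintype m] [Fintype n] [MeasurableSpace α]
    {μ : Measure α} [IsFiniteMeasure μ] (A : Matrix m n ℝ) (b : m → ℝ) {u : α → n → ℝ}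
    (hu : Integrable u μ) :
    ∫ x, (A.mulVec (u x) + b) ∂μ = A.mulVec (∫ x, u x ∂μ) + μ.real Set.univ • b := by
  have hcomm := (LinearMap.toContinuousLinearMap A.mulVecLin).integral_comp_comm hu
  have hint := (LinearMap.toContinuousLinearMap A.mulVecLin).integrable_comp hu
  simp only [LinearMap.coe_toContinuousLinearMap', Matrix.mulVecLin_apply] at hcomm hint
  rw [integral_add hint (integrable_const b), hcomm, integral_const]

lemma integral_mulVec_mul_mulVec {α m n : Type*} [Fintype m] [Fintype n] [MeasurableSpace α]
    {μ : Measure α} (A : Matrix m m ℝ) (B : Matrix n n ℝ) {u : α → m → ℝ} {v : α → n → ℝ}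
    (huv : ∀ k l, Integrable (fun x => u x k * v x l) μ) (i : m) (j : n) :
    ∫ x, A.mulVec (u x) i * B.mulVec (v x) j ∂μ
      = (A * Matrix.of (fun k l => ∫ x, u x k * v x l ∂μ) * B.transpose) i j := by
  have hexpand : ∀ x, A.mulVec (u x) i * B.mulVec (v x) j
      = ∑ l, ∑ k, A i k * B j l * (u x k * v x l) := fun x => by
    simp only [Matrix.mulVec, dotProduct, Finset.sum_mul_sum]
    rw [Finset.sum_comm]
    exact Finset.sum_congr rfl fun l _ => Finset.sum_congr rfl fun k _ => by ring
  simp only [hexpand]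
  rw [integral_finsetSum _ fun l _ => integrable_finsetSum _ fun k _ => (huv k l).const_mul _]
  simp only [Matrix.mul_apply, Matrix.transpose_apply, Matrix.of_apply, Finset.sum_mul]
  refine Finset.sum_congr rfl fun l _ => ?_
  rw [integral_finsetSum _ fun k _ => (huv k l).const_mul _]
  refine Finset.sum_congr rfl fun k _ => ?_
  rw [integral_const_mul]
  ring

lemma memLp_top_restrict_sub_const_apply {α n : Type*} [Fintype n] [MeasurableSpace α]
    {μ : Measure α} {Ω : Set α} (hΩ : MeasurableSet Ω) {u : α → n → ℝ} (hu : Measurable u)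
    {K : ℝ} (hK : ∀ x ∈ Ω, ‖u x‖ ≤ K) (a : n → ℝ) (i : n) :
    MemLp (fun x => u x i - a i) ⊤ (μ.restrict Ω) := by
  refine memLp_top_of_bound
    (((measurable_pi_apply i).comp hu).sub_const (a i)).aestronglyMeasurable (K + ‖a i‖) ?_
  filter_upwards [ae_restrict_mem hΩ] with x hx
  exact (norm_sub_le _ _).trans (by gcongr; exact (norm_le_pi_norm _ i).trans (hK x hx))

lemma integrable_restrict_mul_of_bound {α m n : Type*} [Fintype m] [Fintype n]
    [MeasurableSpace α] {μ : Measure α} {Ω : Set α} (hΩ : MeasurableSet Ω) (hμ : μ Ω ≠ ⊤)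
    {u : α → m → ℝ} {v : α → n → ℝ} (hu : Measurable u) (hv : Measurable v)
    {K L : ℝ} (hK : ∀ x ∈ Ω, ‖u x‖ ≤ K) (hL : ∀ x ∈ Ω, ‖v x‖ ≤ L)
    (a : m → ℝ) (c : n → ℝ) (i : m) (j : n) :
    Integrable (fun x => (u x i - a i) * (v x j - c j)) (μ.restrict Ω) := by
  have : IsFiniteMeasure (μ.restrict Ω) := ⟨by simpa using hμ.lt_top⟩
  exact ((memLp_top_restrict_sub_const_apply hΩ hv hL c j).mul (r := ⊤)
    (memLp_top_restrict_sub_const_apply hΩ hu hK a i)).integrable le_top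

/-- Means transform affinely. -/
lemma smul_setIntegral_affine_image {Ω : Set (Fin 3 → ℝ)} (hΩ : MeasurableSet Ω)
    (hV : 0 < vol3 Ω) {A : Matrix (Fin 3) (Fin 3) ℝ} (hA : 0 < A.det) (b : Fin 3 → ℝ)
    (B : Matrix (Fin 3) (Fin 3) ℝ) (c : Fin 3 → ℝ) {u g : (Fin 3 → ℝ) → (Fin 3 → ℝ)}
    (hu : IntegrableOn u Ω) (hg : ∀ x, g (A.mulVec x + b) = B.mulVec (u x) + c) :
    (vol3 ((fun x => A.mulVec x + b) '' Ω))⁻¹ • ∫ x in (fun x => A.mulVec x + b) '' Ω, g x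
      = B.mulVec ((vol3 Ω)⁻¹ • ∫ x in Ω, u x) + c := by
  have : IsFiniteMeasure (volume.restrict Ω) :=
    ⟨by simpa using (ENNReal.toReal_pos_iff.1 hV).2⟩
  have hvol : (volume.restrict Ω).real Set.univ = vol3 Ω := by simp [Measure.real, vol3]
  have himage : vol3 ((fun x => A.mulVec x + b) '' Ω) = A.det * vol3 Ω :=
    measureReal_affine_image hΩ hA b
  rw [setIntegral_affine_image hΩ hA, himage]
  simp only [hg]
  rw [integral_mulVec_add_const B c hu, hvol, Matrix.mulVec_smul, smul_smul, smul_add, smul_smul]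
  have h₁ : (A.det * vol3 Ω)⁻¹ * A.det = (vol3 Ω)⁻¹ := by field_simp
  rw [h₁, inv_mul_cancel₀ hV.ne', one_smul]

/-- `DAMI₁` is invariant under every dual-affine transformation of a
3D color object `(Ω, f)` with positive determinants. -/
theorem dami1_dual_affine_invariant (Ω : Set (Fin 3 → ℝ))
    (hΩm : MeasurableSet Ω) (hΩb : Bornology.IsBounded Ω)
    (hV : 0 < vol3 Ω)
    (f : (Fin 3 → ℝ) → (Fin 3 → ℝ)) (hfm : Measurable f)
    (hfb : ∃ C : ℝ, ∀ x, ‖f x‖ ≤ C)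
    (hSigma : 0 < (chanCov3 Ω f).det)
    (A_M : Matrix (Fin 3) (Fin 3) ℝ) (hAM : 0 < A_M.det)
    (A_N : Matrix (Fin 3) (Fin 3) ℝ) (hAN : 0 < A_N.det)
    (b c : Fin 3 → ℝ) :
    dami1 ((fun x => A_M.mulVec x + b) '' Ω)
        (fun x => A_N.mulVec (f (A_M⁻¹.mulVec (x - b))) + c)
      = dami1 Ω f := by
  obtain ⟨L, hL⟩ := hfb
  obtain ⟨K, hK⟩ := hΩb.exists_norm_le
  have hfin : volume Ω ≠ ⊤ := hΩb.measure_lt_top.ne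
  have hfi : IntegrableOn f Ω := Measure.integrableOn_of_bounded hfin
    hfm.aestronglyMeasurable (Filter.Eventually.of_forall hL)
  have hxi : IntegrableOn (fun x : Fin 3 → ℝ => x) Ω := Measure.integrableOn_of_bounded hfin
    measurable_id.aestronglyMeasurable ((ae_restrict_mem hΩm).mono hK)
  have hinv : ∀ x, A_M⁻¹.mulVec (A_M.mulVec x + b - b) = x := fun x => by
    rw [add_sub_cancel_right, Matrix.mulVec_mulVec,
      Matrix.nonsing_inv_mul _ hAM.ne'.isUnit, Matrix.one_mulVec]
  set T : (Fin 3 → ℝ) → (Fin 3 → ℝ) := fun x => A_M.mulVec x + b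
  set g : (Fin 3 → ℝ) → (Fin 3 → ℝ) :=
    fun x => A_N.mulVec (f (A_M⁻¹.mulVec (x - b))) + c with hg
  have hgT : ∀ x, g (A_M.mulVec x + b) = A_N.mulVec (f x) + c := fun x => by
    simp only [hg, hinv]
  have hvol : vol3 (T '' Ω) = A_M.det * vol3 Ω := measureReal_affine_image hΩm hAM b
  have hcent : centroid3 (T '' Ω) = A_M.mulVec (centroid3 Ω) + b :=
    smul_setIntegral_affine_image hΩm hV hAM b A_M b hxi fun _ => rfl
  have hmean : meanChan3 (T '' Ω) g = A_N.mulVec (meanChan3 Ω f) + c :=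
    smul_setIntegral_affine_image hΩm hV hAM b A_N c hfi hgT
  have hsub : ∀ (B : Matrix (Fin 3) (Fin 3) ℝ) (d x y : Fin 3 → ℝ) (i : Fin 3),
      (B.mulVec x + d) i - (B.mulVec y + d) i = B.mulVec (x - y) i := fun B d x y i => by
    simp [Matrix.mulVec_sub]
  have hcross : crossCov3 (T '' Ω) g
      = A_M.det • (A_M * crossCov3 Ω f * A_N.transpose) := by
    ext i j
    simp only [crossCov3, Matrix.of_apply, Matrix.smul_apply]
    rw [setIntegral_affine_image hΩm hAM]
    simp only [hgT, hcent, hmean, hsub]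
    exact congrArg (A_M.det * ·) (integral_mulVec_mul_mulVec A_M A_N
      (u := fun x => x - centroid3 Ω) (v := fun x => f x - meanChan3 Ω f)
      (integrable_restrict_mul_of_bound hΩm hfin measurable_id hfm hK (fun x _ => hL x) _ _) i j)
  have hchan : chanCov3 (T '' Ω) g
      = A_M.det • (A_N * chanCov3 Ω f * A_N.transpose) := by
    ext i j
    simp only [chanCov3, Matrix.of_apply, Matrix.smul_apply]
    rw [setIntegral_affine_image hΩm hAM]
    simp only [hgT, hmean, hsub]
    exact congrArg (A_M.det * ·) (integral_mulVec_mul_mulVec A_N A_N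
      (u := fun x => f x - meanChan3 Ω f) (v := fun x => f x - meanChan3 Ω f)
      (integrable_restrict_mul_of_bound hΩm hfin hfm hfm (fun x _ => hL x)
        (fun x _ => hL x) _ _) i j)
  simp only [dami1, hcross, hchan, hvol, Matrix.det_smul, Matrix.det_mul,
    Matrix.det_transpose, Fintype.card_fin]
  set p := A_M.det
  set q := A_N.det
  set s := (chanCov3 Ω f).det
  have hsqrt : √(p ^ 3 * (q * s * q)) = p ^ ((3 : ℝ) / 2) * q * √s := by
    have hp : p ^ 3 = (p ^ ((3 : ℝ) / 2)) ^ 2 := by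
      rw [← Real.rpow_natCast, ← Real.rpow_natCast, ← Real.rpow_mul hAM.le]
      norm_num
    rw [hp, show (p ^ ((3 : ℝ) / 2)) ^ 2 * (q * s * q) = (p ^ ((3 : ℝ) / 2) * q) ^ 2 * s by ring,
      Real.sqrt_mul (by positivity), Real.sqrt_sq (by positivity)]
  have hpow : p ^ ((3 : ℝ) / 2) * p ^ ((5 : ℝ) / 2) = p ^ 4 := by
    rw [← Real.rpow_add hAM, ← Real.rpow_natCast]
    norm_num
  rw [hsqrt, Real.mul_rpow hAM.le hV.le,
    show p ^ 3 * (p * (crossCov3 Ω f).det * q) = (p ^ 4 * q) * (crossCov3 Ω f).det by ring,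
    show p ^ ((3 : ℝ) / 2) * q * √s * (p ^ ((5 : ℝ) / 2) * vol3 Ω ^ ((5 : ℝ) / 2))
      = (p ^ ((3 : ℝ) / 2) * p ^ ((5 : ℝ) / 2) * q) * (√s * vol3 Ω ^ ((5 : ℝ) / 2)) by ring,
    hpow, mul_div_mul_left _ _ (by positivity)]
end

section
/- DAMI(2,2)(1) is a dual-affine invariant of 2D vector fields: with central moments u_{pqrs} of the object (Ω, f) and u*_{pqrs} of the transformed object (Ω*, f*) under any unimodular dual-affine transformation (A_M, A_N ∈ SL(2,ℝ), translations b, c ∈ ℝ²), one has u*_{0101}·u*_{1010} − u*_{0110}·u*_{1001} = u_{0101}·u_{1010} − u_{0110}·u_{1001}. -/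
open MeasureTheory

/-- Centroid `(x̄, ȳ) = V⁻¹ ∫_Ω (x,y) dxdy` of a bounded set `Ω ⊂ ℝ²`. -/
noncomputable def centroid2 (Ω : Set (Fin 2 → ℝ)) : Fin 2 → ℝ :=
  (volume Ω).toReal⁻¹ • ∫ x in Ω, x

/-- Mean `(f̄₁, f̄₂) = V⁻¹ ∫_Ω f dxdy` of a 2D vector field over `Ω`. -/
noncomputable def meanField2 (Ω : Set (Fin 2 → ℝ))
    (f : (Fin 2 → ℝ) → (Fin 2 → ℝ)) : Fin 2 → ℝ :=
  (volume Ω).toReal⁻¹ • ∫ x in Ω, f x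

/-- Central moment
`u_{pqrs} = ∫_Ω (x − x̄)^p (y − ȳ)^q (f₁ − f̄₁)^r (f₂ − f̄₂)^s dxdy`. -/
noncomputable def u (Ω : Set (Fin 2 → ℝ)) (f : (Fin 2 → ℝ) → (Fin 2 → ℝ))
    (p q r s : ℕ) : ℝ :=
  ∫ x in Ω, (x 0 - centroid2 Ω 0) ^ p * (x 1 - centroid2 Ω 1) ^ q *
    (f x 0 - meanField2 Ω f 0) ^ r * (f x 1 - meanField2 Ω f 1) ^ s

/-- The transformed domain `Ω* = {A_M x + b : x ∈ Ω}`. -/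
def domStar (A_M : Matrix.SpecialLinearGroup (Fin 2) ℝ) (b : Fin 2 → ℝ)
    (Ω : Set (Fin 2 → ℝ)) : Set (Fin 2 → ℝ) :=
  (fun x => (A_M : Matrix (Fin 2) (Fin 2) ℝ).mulVec x + b) '' Ω

/-- The transformed vector field `f*(x) = A_N·f(A_M⁻¹(x − b)) + c`. -/
noncomputable def fieldStar (A_M A_N : Matrix.SpecialLinearGroup (Fin 2) ℝ)
    (b c : Fin 2 → ℝ) (f : (Fin 2 → ℝ) → (Fin 2 → ℝ)) :
    (Fin 2 → ℝ) → (Fin 2 → ℝ) :=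
  fun x => (A_N : Matrix (Fin 2) (Fin 2) ℝ).mulVec
      (f ((A_M⁻¹ : Matrix.SpecialLinearGroup (Fin 2) ℝ).1.mulVec (x - b))) + c

open Matrix

/-- A unimodular affine map of the plane preserves Lebesgue measure. -/
lemma measurePreserving_mulVec_add (A : SpecialLinearGroup (Fin 2) ℝ) (b : Fin 2 → ℝ) :
    MeasurePreserving (fun x => (A : Matrix (Fin 2) (Fin 2) ℝ).mulVec x + b) := by
  have hA : MeasurePreserving (toLin' (A : Matrix (Fin 2) (Fin 2) ℝ)) := by
    refine ⟨(LinearMap.continuous_of_finiteDimensional _).measurable, ?_⟩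
    rw [Real.map_matrix_volume_pi_eq_smul_volume_pi (by simp)]
    simp
  exact (measurePreserving_add_right volume b).comp hA

lemma inv_mulVec_mulVec (A : SpecialLinearGroup (Fin 2) ℝ) (x : Fin 2 → ℝ) :
    (A⁻¹).1.mulVec (A.1.mulVec x) = x := by
  have h : (A⁻¹).1 * A.1 = 1 := congrArg Subtype.val (inv_mul_cancel A)
  rw [mulVec_mulVec, h, one_mulVec]

lemma measurableEmbedding_mulVec_add (A : SpecialLinearGroup (Fin 2) ℝ) (b : Fin 2 → ℝ) :
    MeasurableEmbedding (fun x => (A : Matrix (Fin 2) (Fin 2) ℝ).mulVec x + b) := by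
  refine (measurePreserving_mulVec_add A b).measurable.measurableEmbedding fun x y h => ?_
  have h' : A.1.mulVec x = A.1.mulVec y := add_right_cancel h
  rw [← inv_mulVec_mulVec A x, h', inv_mulVec_mulVec]

lemma setIntegral_domStar {E : Type*} [NormedAddCommGroup E] [NormedSpace ℝ E]
    (A : SpecialLinearGroup (Fin 2) ℝ) (b : Fin 2 → ℝ) (Ω : Set (Fin 2 → ℝ))
    (g : (Fin 2 → ℝ) → E) :
    ∫ x in domStar A b Ω, g x = ∫ x in Ω, g (A.1.mulVec x + b) :=
  (measurePreserving_mulVec_add A b).setIntegral_image_emb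
    (measurableEmbedding_mulVec_add A b) g Ω

lemma volume_domStar (A : SpecialLinearGroup (Fin 2) ℝ) (b : Fin 2 → ℝ)
    (Ω : Set (Fin 2 → ℝ)) : volume (domStar A b Ω) = volume Ω := by
  have h := (measurePreserving_mulVec_add A b).measure_preimage_emb
    (measurableEmbedding_mulVec_add A b) (domStar A b Ω)
  rw [← h, domStar, Set.preimage_image_eq _ (measurableEmbedding_mulVec_add A b).injective]

lemma fieldStar_apply (A N : SpecialLinearGroup (Fin 2) ℝ) (b c : Fin 2 → ℝ)
    (f : (Fin 2 → ℝ) → (Fin 2 → ℝ)) (x : Fin 2 → ℝ) :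
    fieldStar A N b c f (A.1.mulVec x + b) = N.1.mulVec (f x) + c := by
  rw [fieldStar, add_sub_cancel_right, inv_mulVec_mulVec]

/-- Averages commute with affine maps. -/
lemma average_mulVec_add {Ω : Set (Fin 2 → ℝ)} (hV : 0 < (volume Ω).toReal)
    {g : (Fin 2 → ℝ) → (Fin 2 → ℝ)} (hg : IntegrableOn g Ω)
    (B : Matrix (Fin 2) (Fin 2) ℝ) (c : Fin 2 → ℝ) :
    (volume Ω).toReal⁻¹ • ∫ x in Ω, (B.mulVec (g x) + c) =
      B.mulVec ((volume Ω).toReal⁻¹ • ∫ x in Ω, g x) + c := by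
  have hfin : volume Ω ≠ ⊤ := (ENNReal.toReal_pos_iff.1 hV).2.ne
  let L : (Fin 2 → ℝ) →L[ℝ] (Fin 2 → ℝ) := LinearMap.toContinuousLinearMap B.mulVecLin
  have hL : ∫ x in Ω, B.mulVec (g x) = B.mulVec (∫ x in Ω, g x) := L.integral_comp_comm hg
  have hLi : IntegrableOn (fun x => B.mulVec (g x)) Ω := L.integrable_comp hg
  rw [integral_add hLi (integrableOn_const hfin), hL, setIntegral_const, smul_add,
    mulVec_smul, Measure.real, smul_smul, inv_mul_cancel₀ hV.ne', one_smul]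

lemma integral_mulVec_mul_mulVec_s5 {α : Type*} [MeasurableSpace α] {μ : Measure α}
    (A N : Matrix (Fin 2) (Fin 2) ℝ) {g h : α → Fin 2 → ℝ}
    (hi : ∀ i j, Integrable (fun x => g x i * h x j) μ) (i j : Fin 2) :
    ∫ x, A.mulVec (g x) i * N.mulVec (h x) j ∂μ =
      ∑ k, ∑ l, A i k * N j l * ∫ x, g x k * h x l ∂μ := by
  have : ∀ x, A.mulVec (g x) i * N.mulVec (h x) j =
      ∑ k, ∑ l, A i k * N j l * (g x k * h x l) := fun x => by
    simp only [mulVec, dotProduct, Fin.sum_univ_two]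
    ring
  simp_rw [this]
  rw [integral_finsetSum _ fun k _ => integrable_finsetSum _ fun l _ => (hi k l).const_mul _]
  refine Finset.sum_congr rfl fun k _ => ?_
  rw [integral_finsetSum _ fun l _ => (hi k l).const_mul _]
  simp_rw [integral_const_mul]

/-- The mixed second central moments of position and field value. -/
noncomputable def mixedMoment (Ω : Set (Fin 2 → ℝ)) (f : (Fin 2 → ℝ) → (Fin 2 → ℝ))
    (i j : Fin 2) : ℝ :=
  ∫ x in Ω, (x - centroid2 Ω) i * (f x - meanField2 Ω f) j

lemma integrableOn_id_of_isBounded {Ω : Set (Fin 2 → ℝ)} (hΩm : MeasurableSet Ω)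
    (hΩb : Bornology.IsBounded Ω) : IntegrableOn (fun x : Fin 2 → ℝ => x) Ω := by
  obtain ⟨C, hC⟩ := hΩb.exists_norm_le
  exact Measure.integrableOn_of_bounded hΩb.measure_lt_top.ne
    measurable_id.aestronglyMeasurable ((ae_restrict_iff' hΩm).2 (.of_forall hC))

lemma mixedMoment_star {Ω : Set (Fin 2 → ℝ)} (hΩm : MeasurableSet Ω)
    (hΩb : Bornology.IsBounded Ω) (hV : 0 < (volume Ω).toReal)
    {f : (Fin 2 → ℝ) → (Fin 2 → ℝ)} (hfm : Measurable f) (hfb : ∃ C : ℝ, ∀ x, ‖f x‖ ≤ C)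
    (A N : SpecialLinearGroup (Fin 2) ℝ) (b c : Fin 2 → ℝ) (i j : Fin 2) :
    mixedMoment (domStar A b Ω) (fieldStar A N b c f) i j =
      ∑ k, ∑ l, A.1 i k * N.1 j l * mixedMoment Ω f k l := by
  have hfin : volume Ω ≠ ⊤ := hΩb.measure_lt_top.ne
  have hid := integrableOn_id_of_isBounded hΩm hΩb
  obtain ⟨C, hC⟩ := hfb
  have hf : IntegrableOn f Ω := Measure.integrableOn_of_bounded hfin
    hfm.aestronglyMeasurable (.of_forall hC)
  have hcen : centroid2 (domStar A b Ω) = A.1.mulVec (centroid2 Ω) + b := by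
    rw [centroid2, volume_domStar, setIntegral_domStar, average_mulVec_add hV hid, centroid2]
  have hmean : meanField2 (domStar A b Ω) (fieldStar A N b c f) =
      N.1.mulVec (meanField2 Ω f) + c := by
    simp_rw [meanField2, volume_domStar, setIntegral_domStar, fieldStar_apply]
    exact average_mulVec_add hV hf _ _
  have hint : ∀ k l, IntegrableOn
      (fun x => (x - centroid2 Ω) k * (f x - meanField2 Ω f) l) Ω := fun k l => by
    have hx : IntegrableOn (fun x : Fin 2 → ℝ => (x - centroid2 Ω) k) Ω :=
      Integrable.eval (hid.sub (integrableOn_const hfin)) k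
    refine Integrable.mul_bdd (c := C + ‖meanField2 Ω f‖) hx ?_ (.of_forall fun x => ?_)
    · exact ((measurable_pi_apply l).comp (hfm.sub_const _)).aestronglyMeasurable
    · exact (norm_le_pi_norm _ l).trans ((norm_sub_le _ _).trans (by gcongr; exact hC x))
  rw [mixedMoment, setIntegral_domStar]
  simp_rw [fieldStar_apply, hcen, hmean, add_sub_add_right_eq_sub, ← mulVec_sub]
  exact integral_mulVec_mul_mulVec_s5 _ _ hint i j

/-- DAMI(2,2)(one) is a dual-affine invariant of 2D vector fields
under any unimodular dual-affine transformation. -/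
theorem dami22_one (Ω : Set (Fin 2 → ℝ))
    (hΩm : MeasurableSet Ω) (hΩb : Bornology.IsBounded Ω)
    (hV : 0 < (volume Ω).toReal)
    (f : (Fin 2 → ℝ) → (Fin 2 → ℝ)) (hfm : Measurable f)
    (hfb : ∃ C : ℝ, ∀ x, ‖f x‖ ≤ C)
    (A_M A_N : Matrix.SpecialLinearGroup (Fin 2) ℝ) (b c : Fin 2 → ℝ) :
    (let v := u (domStar A_M b Ω) (fieldStar A_M A_N b c f);
      v 0 1 0 1 * v 1 0 1 0 - v 0 1 1 0 * v 1 0 0 1)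
      =
    (let v := u Ω f;
      v 0 1 0 1 * v 1 0 1 0 - v 0 1 1 0 * v 1 0 0 1) := by
  have hu (Ω' : Set (Fin 2 → ℝ)) (f' : (Fin 2 → ℝ) → (Fin 2 → ℝ)) :
      u Ω' f' 0 1 0 1 = mixedMoment Ω' f' 1 1 ∧ u Ω' f' 1 0 1 0 = mixedMoment Ω' f' 0 0 ∧
      u Ω' f' 0 1 1 0 = mixedMoment Ω' f' 1 0 ∧ u Ω' f' 1 0 0 1 = mixedMoment Ω' f' 0 1 := by
    simp [u, mixedMoment]
  obtain ⟨h1, h2, h3, h4⟩ := hu (domStar A_M b Ω) (fieldStar A_M A_N b c f)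
  obtain ⟨k1, k2, k3, k4⟩ := hu Ω f
  have hA := A_M.2
  have hN := A_N.2
  rw [det_fin_two] at hA hN
  simp only [h1, h2, h3, h4, k1, k2, k3, k4, mixedMoment_star hΩm hΩb hV hfm hfb,
    Fin.sum_univ_two]
  set D := mixedMoment Ω f 1 1 * mixedMoment Ω f 0 0 -
    mixedMoment Ω f 1 0 * mixedMoment Ω f 0 1 with hD
  calc _ = (A_M.1 0 0 * A_M.1 1 1 - A_M.1 0 1 * A_M.1 1 0) *
        (A_N.1 0 0 * A_N.1 1 1 - A_N.1 0 1 * A_N.1 1 0) * D := by rw [hD]; ring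
    _ = D := by rw [hA, hN]; ring
end

section
/- The DAMI(3,3) covariant with kernel combination D_S(1,2,3)·D_C(1,2,4)² (ID 9 in the complete set of degree and order at most 4) vanishes identically: for every bounded measurable set Ω ⊂ ℝ³ and every bounded measurable f : ℝ³ → ℝ³, ∫_{Ω⁴} det(x₁, x₂, x₃) · det(f(x₁), f(x₂), f(x₄))² dx₁dx₂dx₃dx₄ = 0. -/
open MeasureTheory

/-- `det3 u v w` is the determinant of the 3×3 matrix with columns `u, v, w`. -/
def det3 (u v w : Fin 3 → ℝ) : ℝ :=
  (Matrix.of fun i j => ![u, v, w] j i).det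

theorem det3_swap (u v w : Fin 3 → ℝ) : det3 v u w = -det3 u v w := by
  simp only [det3, Matrix.det_fin_three, Matrix.of_apply, Matrix.cons_val]
  ring

/-- Integrals over a cube `Ωⁿ` are invariant under permuting the coordinates. -/
theorem setIntegral_pi_comp_perm {ι α E : Type*} [Fintype ι] [MeasureSpace α]
    [SigmaFinite (volume : Measure α)] [NormedAddCommGroup E] [NormedSpace ℝ E]
    (Ω : Set α) (g : (ι → α) → E) (σ : Equiv.Perm ι) :
    ∫ x in Set.univ.pi (fun _ => Ω), g (x ∘ σ) = ∫ x in Set.univ.pi (fun _ => Ω), g x := by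
  have e := volume_measurePreserving_piCongrLeft (fun _ : ι => α) σ.symm
  have happ (x : ι → α) :
      MeasurableEquiv.piCongrLeft (fun _ : ι => α) σ.symm x = x ∘ σ := by
    ext i
    obtain ⟨j, rfl⟩ := σ.symm.surjective i
    rw [MeasurableEquiv.coe_piCongrLeft, Equiv.piCongrLeft_apply_apply]
    simp
  have hpre : MeasurableEquiv.piCongrLeft (fun _ : ι => α) σ.symm ⁻¹'
      Set.univ.pi (fun _ => Ω) = Set.univ.pi (fun _ => Ω) := by
    ext x
    simp only [Set.mem_preimage, happ, Set.mem_univ_pi, Function.comp_apply]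
    exact σ.forall_congr_right (q := fun i => x i ∈ Ω)
  have h := e.setIntegral_preimage_emb (MeasurableEquiv.measurableEmbedding _) g
    (Set.univ.pi fun _ => Ω)
  simpa only [hpre, happ] using h

/-- the DAMI(3,3) covariant with kernel combination
D_S(1,2,3)·D_C(1,2,4)² (ID 9 in the complete set of degree and order at most 4)
vanishes identically. -/
theorem dami33_id9_vanishes (Ω : Set (Fin 3 → ℝ))
    (hΩm : MeasurableSet Ω) (hΩb : Bornology.IsBounded Ω)
    (f : (Fin 3 → ℝ) → (Fin 3 → ℝ)) (hfm : Measurable f)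
    (hfb : ∃ C : ℝ, ∀ x, ‖f x‖ ≤ C) :
    (∫ x : Fin 4 → (Fin 3 → ℝ) in Set.univ.pi (fun _ => Ω),
        det3 (x 0) (x 1) (x 2) * det3 (f (x 0)) (f (x 1)) (f (x 3)) ^ 2)
      = 0 := by
  have h := setIntegral_pi_comp_perm Ω
    (fun x : Fin 4 → (Fin 3 → ℝ) =>
      det3 (x 0) (x 1) (x 2) * det3 (f (x 0)) (f (x 1)) (f (x 3)) ^ 2) (Equiv.swap 0 1)
  have h2 : Equiv.swap (0 : Fin 4) 1 2 = 2 := by decide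
  have h3 : Equiv.swap (0 : Fin 4) 1 3 = 3 := by decide
  simp only [Function.comp_apply, Equiv.swap_apply_left, Equiv.swap_apply_right, h2, h3] at h
  have hneg (x : Fin 4 → (Fin 3 → ℝ)) :
      det3 (x 1) (x 0) (x 2) * det3 (f (x 1)) (f (x 0)) (f (x 3)) ^ 2
        = -(det3 (x 0) (x 1) (x 2) * det3 (f (x 0)) (f (x 1)) (f (x 3)) ^ 2) := by
    rw [det3_swap (x 0), det3_swap (f (x 0))]
    ring
  simp only [hneg, integral_neg] at h
  linarith
end

section
/- The DAMI(3,3) covariant with kernel combination D_S(1,2,3)·D_S(1,2,4)·D_C(1,2,3) (ID 13 in the complete set of degree and order at most 4) vanishes identically: for every bounded measurable set Ω ⊂ ℝ³ and every bounded measurable f : ℝ³ → ℝ³, ∫_{Ω⁴} det(x₁, x₂, x₃) · det(x₁, x₂, x₄) · det(f(x₁), f(x₂), f(x₃)) dx₁dx₂dx₃dx₄ = 0. -/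
open MeasureTheory

/-- the DAMI(3,3) covariant with kernel combination
D_S(1,2,3)·D_S(1,2,4)·D_C(1,2,3) (ID 13 in the complete set of degree and order at most 4)
vanishes identically. -/
theorem dami33_id13_vanishes (Ω : Set (Fin 3 → ℝ))
    (hΩm : MeasurableSet Ω) (hΩb : Bornology.IsBounded Ω)
    (f : (Fin 3 → ℝ) → (Fin 3 → ℝ)) (hfm : Measurable f)
    (hfb : ∃ C : ℝ, ∀ x, ‖f x‖ ≤ C) :
    (∫ x : Fin 4 → (Fin 3 → ℝ) in Set.univ.pi (fun _ => Ω),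
        det3 (x 0) (x 1) (x 2) * det3 (x 0) (x 1) (x 3) * det3 (f (x 0)) (f (x 1)) (f (x 2)))
      = 0 := by
  set F : (Fin 4 → (Fin 3 → ℝ)) → ℝ := fun x =>
    det3 (x 0) (x 1) (x 2) * det3 (x 0) (x 1) (x 3) * det3 (f (x 0)) (f (x 1)) (f (x 2)) with hF
  let e := MeasurableEquiv.piCongrLeft (fun _ : Fin 4 => Fin 3 → ℝ) (Equiv.swap 0 1)
  have he : MeasurePreserving e volume volume :=
    volume_measurePreserving_piCongrLeft (fun _ : Fin 4 => Fin 3 → ℝ) (Equiv.swap 0 1)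
  have happ : ∀ x i, e x i = x (Equiv.swap 0 1 i) := fun x i => by
    obtain ⟨j, rfl⟩ := (Equiv.swap (0 : Fin 4) 1).surjective i
    rw [Equiv.swap_apply_self]
    exact Equiv.piCongrLeft_apply_apply (fun _ : Fin 4 => Fin 3 → ℝ) (Equiv.swap 0 1) x j
  have hpre : e ⁻¹' Set.univ.pi (fun _ => Ω) = Set.univ.pi (fun _ => Ω) := by
    ext x
    simp only [Set.mem_preimage, Set.mem_univ_pi, happ]
    exact (Equiv.swap (0 : Fin 4) 1).forall_congr_right (q := fun i => x i ∈ Ω)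
  have hodd : ∀ x, F (e x) = -F x := fun x => by
    have h2 : Equiv.swap (0 : Fin 4) 1 2 = 2 := by decide
    have h3 : Equiv.swap (0 : Fin 4) 1 3 = 3 := by decide
    simp only [hF, happ, Equiv.swap_apply_left, Equiv.swap_apply_right, h2, h3]
    rw [det3_swap (x 0), det3_swap (x 0), det3_swap (f (x 0))]
    ring
  have h := he.setIntegral_preimage_emb e.measurableEmbedding F (Set.univ.pi fun _ => Ω)
  simp only [hpre, hodd, integral_neg] at h
  linarith
end

section
/- The DAMI(3,3) covariant with kernel combination D_S(1,2,3)·D_C(1,2,3)·D_C(1,2,4) (ID 17 in the complete set of degree and order at most 4) vanishes identically: for every bounded measurable set Ω ⊂ ℝ³ and every bounded measurable f : ℝ³ → ℝ³, ∫_{Ω⁴} det(x₁, x₂, x₃) · det(f(x₁), f(x₂), f(x₃)) · det(f(x₁), f(x₂), f(x₄)) dx₁dx₂dx₃dx₄ = 0. -/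
open MeasureTheory

/-- The integral over a power `Ω^ι` is invariant under permuting the variables. -/
theorem setIntegral_univ_pi_comp_perm {ι α : Type*} [Fintype ι] [MeasureSpace α]
    [SigmaFinite (volume : Measure α)] (Ω : Set α) (σ : Equiv.Perm ι) (F : (ι → α) → ℝ) :
    ∫ x in Set.univ.pi (fun _ => Ω), F (fun i => x (σ i)) =
      ∫ x in Set.univ.pi (fun _ => Ω), F x := by
  have h := volume_measurePreserving_piCongrLeft (fun _ : ι => α) σ.symm
  have key := h.setIntegral_preimage_emb
    (MeasurableEquiv.measurableEmbedding _) F (Set.univ.pi fun _ => Ω)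
  have happ : ∀ x : ι → α,
      MeasurableEquiv.piCongrLeft (fun _ : ι => α) σ.symm x = fun i => x (σ i) := by
    intro x
    ext i
    simpa using MeasurableEquiv.piCongrLeft_apply_apply (β := fun _ : ι => α) σ.symm x (σ i)
  have hpre : MeasurableEquiv.piCongrLeft (fun _ : ι => α) σ.symm ⁻¹'
      (Set.univ.pi fun _ => Ω) = Set.univ.pi fun _ => Ω := by
    ext x
    simp only [Set.mem_preimage, happ, Set.mem_univ_pi]
    exact ⟨fun hx i => by simpa using hx (σ.symm i), fun hx i => hx _⟩
  rw [hpre] at key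
  simpa only [happ] using key

/-- the DAMI(3,3) covariant with kernel combination
D_S(1,2,3)·D_C(1,2,3)·D_C(1,2,4) (ID 17 in the complete set of degree and order at most 4)
vanishes identically. -/
theorem dami33_id17_vanishes (Ω : Set (Fin 3 → ℝ))
    (hΩm : MeasurableSet Ω) (hΩb : Bornology.IsBounded Ω)
    (f : (Fin 3 → ℝ) → (Fin 3 → ℝ)) (hfm : Measurable f)
    (hfb : ∃ C : ℝ, ∀ x, ‖f x‖ ≤ C) :
    (∫ x : Fin 4 → (Fin 3 → ℝ) in Set.univ.pi (fun _ => Ω),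
        det3 (x 0) (x 1) (x 2) * det3 (f (x 0)) (f (x 1)) (f (x 2)) * det3 (f (x 0)) (f (x 1)) (f (x 3)))
      = 0 := by
  have h := setIntegral_univ_pi_comp_perm Ω (Equiv.swap (0 : Fin 4) 1) fun x =>
    det3 (x 0) (x 1) (x 2) * det3 (f (x 0)) (f (x 1)) (f (x 2)) *
      det3 (f (x 0)) (f (x 1)) (f (x 3))
  have h2 : Equiv.swap (0 : Fin 4) 1 2 = 2 := by decide
  have h3 : Equiv.swap (0 : Fin 4) 1 3 = 3 := by decide
  simp only [Equiv.swap_apply_left, Equiv.swap_apply_right, h2, h3] at h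
  simp_rw [fun x : Fin 4 → (Fin 3 → ℝ) => det3_swap (x 0) (x 1) (x 2),
    fun x : Fin 4 → (Fin 3 → ℝ) => det3_swap (f (x 0)) (f (x 1)),
    neg_mul_neg, mul_neg, integral_neg] at h
  linarith
end

section
/- The DAMI(3,3) covariant with kernel combination D_S(1,2,3)·D_S(1,3,4)·D_C(1,2,4) (ID 21 in the complete set of degree and order at most 4) vanishes identically: for every bounded measurable set Ω ⊂ ℝ³ and every bounded measurable f : ℝ³ → ℝ³, ∫_{Ω⁴} det(x₁, x₂, x₃) · det(x₁, x₃, x₄) · det(f(x₁), f(x₂), f(x₄)) dx₁dx₂dx₃dx₄ = 0. -/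
open MeasureTheory

theorem det3_swap_right (u v w : Fin 3 → ℝ) : det3 u w v = -det3 u v w := by
  simp only [det3, Matrix.det_fin_three, Matrix.of_apply, Matrix.cons_val]
  ring

/-- The integral over `Ω ^ ι` of a function that is odd under a permutation of the variables
vanishes. -/
theorem setIntegral_pi_eq_zero_of_odd {ι E : Type*} [Fintype ι] [MeasureSpace E]
    [SigmaFinite (volume : Measure E)] (σ : Equiv.Perm ι) (Ω : Set E) (g : (ι → E) → ℝ)
    (hg : ∀ x, g (x ∘ σ) = -g x) : ∫ x in Set.univ.pi (fun _ : ι => Ω), g x = 0 := by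
  let e : (ι → E) ≃ᵐ (ι → E) := MeasurableEquiv.piCongrLeft (fun _ => E) σ.symm
  have he : ∀ x, e x = x ∘ σ := by
    intro x
    ext i
    simpa [e, MeasurableEquiv.coe_piCongrLeft] using
      Equiv.piCongrLeft_apply_apply (fun _ => E) σ.symm x (σ i)
  have hpre : e ⁻¹' Set.univ.pi (fun _ => Ω) = Set.univ.pi (fun _ => Ω) := by
    ext x
    simpa [he] using σ.forall_congr_right (q := fun i => x i ∈ Ω)
  have hint := MeasurePreserving.setIntegral_preimage_emb
    (volume_measurePreserving_piCongrLeft (fun _ : ι => E) σ.symm)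
    e.measurableEmbedding g (Set.univ.pi fun _ => Ω)
  change ∫ x in e ⁻¹' _, g (e x) = _ at hint
  simp only [hpre, he, hg, integral_neg] at hint
  linarith

/-- the DAMI(3,3) covariant with kernel combination
D_S(1,2,3)·D_S(1,3,4)·D_C(1,2,4) (ID 21 in the complete set of degree and order at most 4)
vanishes identically. -/
theorem dami33_id21_vanishes (Ω : Set (Fin 3 → ℝ))
    (hΩm : MeasurableSet Ω) (hΩb : Bornology.IsBounded Ω)
    (f : (Fin 3 → ℝ) → (Fin 3 → ℝ)) (hfm : Measurable f)
    (hfb : ∃ C : ℝ, ∀ x, ‖f x‖ ≤ C) :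
    (∫ x : Fin 4 → (Fin 3 → ℝ) in Set.univ.pi (fun _ => Ω),
        det3 (x 0) (x 1) (x 2) * det3 (x 0) (x 2) (x 3) * det3 (f (x 0)) (f (x 1)) (f (x 3)))
      = 0 := by
  refine setIntegral_pi_eq_zero_of_odd (Equiv.swap 1 3) Ω _ fun x => ?_
  have h0 : Equiv.swap (1 : Fin 4) 3 0 = 0 := by decide
  have h2 : Equiv.swap (1 : Fin 4) 3 2 = 2 := by decide
  simp only [Function.comp_apply, h0, h2, Equiv.swap_apply_left, Equiv.swap_apply_right]
  rw [det3_swap_right (x 0) (x 2) (x 3), det3_swap_right (x 0) (x 1) (x 2),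
    det3_swap_right (f (x 0)) (f (x 1)) (f (x 3))]
  ring
end

section
/- The DAMI(3,3) covariant with kernel combination D_S(1,2,3)·D_C(1,3,4)·D_C(1,2,4) (ID 24 in the complete set of degree and order at most 4) vanishes identically: for every bounded measurable set Ω ⊂ ℝ³ and every bounded measurable f : ℝ³ → ℝ³, ∫_{Ω⁴} det(x₁, x₂, x₃) · det(f(x₁), f(x₃), f(x₄)) · det(f(x₁), f(x₂), f(x₄)) dx₁dx₂dx₃dx₄ = 0. -/
open MeasureTheory

/-- the DAMI(3,3) covariant with kernel combination
D_S(1,2,3)·D_C(1,3,4)·D_C(1,2,4) (ID 24 in the complete set of degree and order at most 4)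
vanishes identically. -/
theorem dami33_id24_vanishes (Ω : Set (Fin 3 → ℝ))
    (hΩm : MeasurableSet Ω) (hΩb : Bornology.IsBounded Ω)
    (f : (Fin 3 → ℝ) → (Fin 3 → ℝ)) (hfm : Measurable f)
    (hfb : ∃ C : ℝ, ∀ x, ‖f x‖ ≤ C) :
    (∫ x : Fin 4 → (Fin 3 → ℝ) in Set.univ.pi (fun _ => Ω),
        det3 (x 0) (x 1) (x 2) * det3 (f (x 0)) (f (x 2)) (f (x 3)) * det3 (f (x 0)) (f (x 1)) (f (x 3)))
      = 0 := by
  let e := MeasurableEquiv.piCongrLeft (fun _ : Fin 4 => Fin 3 → ℝ) (Equiv.swap 1 2)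
  have he : ∀ (x : Fin 4 → Fin 3 → ℝ) i, e x i = x (Equiv.swap 1 2 i) := fun x i => by
    simpa using MeasurableEquiv.piCongrLeft_apply_apply (β := fun _ : Fin 4 => Fin 3 → ℝ)
      (Equiv.swap 1 2) x (Equiv.swap 1 2 i)
  have hpre : e ⁻¹' Set.univ.pi (fun _ => Ω) = Set.univ.pi (fun _ => Ω) := by
    ext x
    simp only [Set.mem_preimage, Set.mem_univ_pi, he]
    exact (Equiv.swap (1 : Fin 4) 2).forall_congr_right (q := fun i => x i ∈ Ω)
  have hmp : MeasurePreserving e volume volume :=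
    volume_measurePreserving_piCongrLeft (fun _ : Fin 4 => Fin 3 → ℝ) (Equiv.swap 1 2)
  have h := hmp.setIntegral_preimage_emb e.measurableEmbedding
    (fun x : Fin 4 → (Fin 3 → ℝ) => det3 (x 0) (x 1) (x 2) *
      det3 (f (x 0)) (f (x 2)) (f (x 3)) * det3 (f (x 0)) (f (x 1)) (f (x 3)))
    (Set.univ.pi fun _ => Ω)
  have h0 : Equiv.swap (1 : Fin 4) 2 0 = 0 := by decide
  have h3 : Equiv.swap (1 : Fin 4) 2 3 = 3 := by decide
  simp only [hpre, he, h0, h3, Equiv.swap_apply_left, Equiv.swap_apply_right] at h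
  refine self_eq_neg.mp (h.symm.trans ?_)
  rw [← integral_neg]
  congr 1 with x
  rw [det3_swap_right (x 0) (x 1) (x 2)]
  ring
end
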